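/- Let A be a normal domain with fraction field K, L a finite Galois extension of K with Galois group G, and B the integral closure of A in L. If q ∈ Spec(B) lies over p ∈ Spec(A), then the residue field extension k(q)/k(p) is algebraic and normal, and the sequence 1 → I_q → D_q → Aut(k(q)/k(p)) → 1 is exact, where D_q = {σ ∈ G : σ(q) = q} is the decomposition group and I_q ⊆ D_q is the subgroup of elements acting trivially on k(q). -/

import Mathlib

/-- The decomposition group condition: `σ` stabilizes the prime `q` of `B`
(acting through the restriction `Aut(L/K) → Aut(B/A)`). -/
def IsDecomp (A K L B : Type*) [CommRing A] [CommRing B] [Algebra A B] [Field K] [Field L]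
    [Algebra A K] [IsFractionRing A K] [Algebra B L] [Algebra K L] [Algebra A L]
    [IsScalarTower A B L] [IsScalarTower A K L] [IsIntegralClosure B A L]
    [FiniteDimensional K L] (q : Ideal B) (σ : L ≃ₐ[K] L) : Prop :=
  ∀ b : B, galRestrict A K L B σ b ∈ q ↔ b ∈ q

/-- The inertia group condition: `σ` acts trivially on the residue ring `B ⧸ q`. -/
def IsInertia (A K L B : Type*) [CommRing A] [CommRing B] [Algebra A B] [Field K] [Field L]
    [Algebra A K] [IsFractionRing A K] [Algebra B L] [Algebra K L] [Algebra A L]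
    [IsScalarTower A B L] [IsScalarTower A K L] [IsIntegralClosure B A L]
    [FiniteDimensional K L] (q : Ideal B) (σ : L ≃ₐ[K] L) : Prop :=
  ∀ b : B, galRestrict A K L B σ b - b ∈ q

open scoped Pointwise in
theorem Ideal.mem_stabilizer_iff_forall_smul_mem_iff {G B : Type*} [Group G] [CommRing B]
    [MulSemiringAction G B] (q : Ideal B) (g : G) :
    g ∈ MulAction.stabilizer G q ↔ ∀ b : B, g • b ∈ q ↔ b ∈ q := by
  rw [MulAction.mem_stabilizer_iff]
  refine ⟨fun h b ↦ ?_, fun h ↦ Ideal.ext fun b ↦ ?_⟩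
  · conv_lhs => rw [← h]
    exact Ideal.smul_mem_pointwise_smul_iff
  · rw [Ideal.mem_pointwise_smul_iff_inv_smul_mem, ← h, smul_inv_smul]

open scoped Pointwise in
/-- Let `A` be a normal (integrally closed) domain with fraction field `K`, `L/K` a finite
Galois extension with Galois group `G = L ≃ₐ[K] L`, and `B` the integral closure of `A` in `L`.
If `q ∈ Spec B` lies over `p ∈ Spec A`, then the residue field extension `k(q)/k(p)` is
algebraic and normal, and `1 → I_q → D_q → Aut(k(q)/k(p)) → 1` is exact. -/
theorem statement0
    (A K L B : Type*) [CommRing A] [IsDomain A] [IsIntegrallyClosed A] [CommRing B]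
    [Algebra A B] [Field K] [Field L] [Algebra A K] [IsFractionRing A K] [Algebra B L]
    [Algebra K L] [Algebra A L] [IsScalarTower A B L] [IsScalarTower A K L]
    [IsIntegralClosure B A L] [FiniteDimensional K L] [IsGalois K L]
    (q : Ideal B) [q.IsPrime] (p : Ideal A) (hp : p = Ideal.comap (algebraMap A B) q)
    -- `kq` is the residue field of `q` and `kp` is the residue field of `p`
    (kp kq : Type*) [Field kp] [Field kq]
    [Algebra (A ⧸ p) kp] [IsFractionRing (A ⧸ p) kp]
    [Algebra (B ⧸ q) kq] [IsFractionRing (B ⧸ q) kq]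
    [Algebra kp kq]
    (hcompat : ∀ a : A,
      algebraMap kp kq (algebraMap (A ⧸ p) kp (Ideal.Quotient.mk p a)) =
        algebraMap (B ⧸ q) kq (Ideal.Quotient.mk q (algebraMap A B a))) :
    Algebra.IsAlgebraic kp kq ∧ Normal kp kq ∧
      ∃ φ : (L ≃ₐ[K] L) → (kq ≃ₐ[kp] kq),
        -- `φ` is the natural reduction map on the decomposition group
        (∀ σ, IsDecomp A K L B q σ → ∀ b : B,
          φ σ (algebraMap (B ⧸ q) kq (Ideal.Quotient.mk q b)) =
            algebraMap (B ⧸ q) kq (Ideal.Quotient.mk q (galRestrict A K L B σ b))) ∧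
        -- `φ` is a group homomorphism on the decomposition group
        (∀ σ τ, IsDecomp A K L B q σ → IsDecomp A K L B q τ →
          φ (σ * τ) = φ σ * φ τ) ∧
        -- exactness at `Aut(k(q)/k(p))` : `φ` is surjective from the decomposition group
        (∀ ρ : kq ≃ₐ[kp] kq, ∃ σ, IsDecomp A K L B q σ ∧ φ σ = ρ) ∧
        -- exactness in the middle: the kernel of `φ` is exactly the inertia group
        (∀ σ, IsDecomp A K L B q σ → (φ σ = 1 ↔ IsInertia A K L B q σ)) := by
  classical
  have : IsDomain B :=
    (IsIntegralClosure.equiv A B L (integralClosure A L)).toMulEquiv.isDomain (integralClosure A L)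
  have : IsFractionRing B L := IsIntegralClosure.isFractionRing_of_finite_extension A K L B
  let : MulSemiringAction (L ≃ₐ[K] L) B := IsIntegralClosure.MulSemiringAction A K L B
  have : SMulCommClass (L ≃ₐ[K] L) A B := ⟨fun g a b ↦ map_smul (galRestrict A K L B g) a b⟩
  have : Algebra.IsInvariant A B (L ≃ₐ[K] L) := Algebra.isInvariant_of_isGalois A K L B
  have : Algebra.IsIntegral A B := Algebra.IsInvariant.isIntegral A B (L ≃ₐ[K] L)
  have : q.LiesOver p := ⟨hp⟩
  have : p.IsPrime := hp ▸ Ideal.IsPrime.under A q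
  let : Algebra (A ⧸ p) kq := ((algebraMap kp kq).comp (algebraMap (A ⧸ p) kp)).toAlgebra
  have : IsScalarTower (A ⧸ p) kp kq := .of_algebraMap_eq fun _ ↦ rfl
  have : IsScalarTower (A ⧸ p) (B ⧸ q) kq := .of_algebraMap_eq fun x ↦ by
    obtain ⟨a, rfl⟩ := Ideal.Quotient.mk_surjective x
    exact hcompat a
  have hnormal : Normal kp kq := Ideal.IsFractionRing.normal (L ≃ₐ[K] L) p q kp kq
  have hD (σ : L ≃ₐ[K] L) :
      σ ∈ MulAction.stabilizer (L ≃ₐ[K] L) q ↔ IsDecomp A K L B q σ :=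
    q.mem_stabilizer_iff_forall_smul_mem_iff σ
  obtain ⟨ψ, hψ_mk, hψ_surj⟩ :
      ∃ ψ : MulAction.stabilizer (L ≃ₐ[K] L) q →* (kq ≃ₐ[kp] kq),
        (∀ σ b, ψ σ (algebraMap (B ⧸ q) kq (Ideal.Quotient.mk q b)) =
          algebraMap (B ⧸ q) kq (Ideal.Quotient.mk q (σ.1 • b))) ∧ Function.Surjective ψ :=
    ⟨IsFractionRing.stabilizerHom (L ≃ₐ[K] L) p q kp kq,
      IsFractionRing.stabilizerHom_apply_apply_mk _ p q kp kq,
      IsFractionRing.stabilizerHom_surjective _ p q kp kq⟩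
  let φ : (L ≃ₐ[K] L) → (kq ≃ₐ[kp] kq) := fun σ ↦
    if h : σ ∈ MulAction.stabilizer (L ≃ₐ[K] L) q then ψ ⟨σ, h⟩ else 1
  have hφ (σ : MulAction.stabilizer (L ≃ₐ[K] L) q) : φ σ = ψ σ := dif_pos σ.2
  have hφ_mk (σ : L ≃ₐ[K] L) (hσ : IsDecomp A K L B q σ) (b : B) :
      φ σ (algebraMap (B ⧸ q) kq (Ideal.Quotient.mk q b)) =
        algebraMap (B ⧸ q) kq (Ideal.Quotient.mk q (galRestrict A K L B σ b)) := by
    rw [hφ ⟨σ, (hD σ).2 hσ⟩]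
    exact hψ_mk _ b
  refine ⟨hnormal.toIsAlgebraic, hnormal, φ, hφ_mk, fun σ τ hσ hτ ↦ ?_, fun ρ ↦ ?_,
    fun σ hσ ↦ ⟨fun h b ↦ ?_, fun h ↦ ?_⟩⟩
  · let s : MulAction.stabilizer (L ≃ₐ[K] L) q := ⟨σ, (hD σ).2 hσ⟩
    let t : MulAction.stabilizer (L ≃ₐ[K] L) q := ⟨τ, (hD τ).2 hτ⟩
    exact (hφ (s * t)).trans ((map_mul ψ s t).trans (congrArg₂ (· * ·) (hφ s) (hφ t)).symm)
  · obtain ⟨σ, hσ⟩ := hψ_surj ρ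
    exact ⟨σ, (hD σ).1 σ.2, (hφ σ).trans hσ⟩
  · have hb := hφ_mk σ hσ b
    rw [h, AlgEquiv.one_apply] at hb
    exact Ideal.Quotient.eq.1 (IsFractionRing.injective (B ⧸ q) kq hb.symm)
  · have hfix (x : B ⧸ q) : φ σ (algebraMap (B ⧸ q) kq x) = algebraMap (B ⧸ q) kq x := by
      obtain ⟨b, rfl⟩ := Ideal.Quotient.mk_surjective x
      rw [hφ_mk σ hσ, Ideal.Quotient.eq.2 (h b)]
    ext x
    obtain ⟨x, y, -, rfl⟩ := IsFractionRing.div_surjective (B ⧸ q) x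
    rw [map_div₀, hfix, hfix, AlgEquiv.one_apply]
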